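/- Let Z₀ > 0, σ > 0, and for x ≥ 0 define C^Ba(x) = Z₀ σ √(x/(2π)) and C(x) = Z₀ (Φ(σ√x/2) − Φ(−σ√x/2)). Let μ be a probability measure on [0,∞) with ∫ x^{3/2} dμ(x) < ∞. Then 0 ≤ ∫ (C^Ba(x) − C(x)) dμ(x) ≤ (Z₀/(12√(2π))) σ³ ∫ x^{3/2} dμ(x). -/

import Mathlib

open MeasureTheory Real

/-- The standard normal cumulative distribution function
`Φ(x) = (1/√(2π)) ∫_{−∞}^x e^{−u²/2} du`. -/
noncomputable def stdNormalCDF (x : ℝ) : ℝ :=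
  (Real.sqrt (2 * Real.pi))⁻¹ * ∫ u in Set.Iic x, Real.exp (-u ^ 2 / 2)

/-- At-the-money, zero-interest-rate Bachelier call price with expiry `x` and
Bachelier volatility `σ Z₀`: `C^Ba(x) = Z₀ σ √(x/(2π))`. -/
noncomputable def bachelierCall (Z₀ σ x : ℝ) : ℝ :=
  Z₀ * σ * Real.sqrt (x / (2 * Real.pi))

/-- At-the-money, zero-interest-rate Black–Scholes call price with expiry `x` and
volatility `σ`: `C(x) = Z₀ (Φ(σ√x/2) − Φ(−σ√x/2))`. -/
noncomputable def bsCall (Z₀ σ x : ℝ) : ℝ :=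
  Z₀ * (stdNormalCDF (σ * Real.sqrt x / 2) - stdNormalCDF (-(σ * Real.sqrt x / 2)))

lemma integrable_exp_neg_sq_div_two : Integrable fun u : ℝ => Real.exp (-u ^ 2 / 2) := by
  refine (integrable_exp_neg_mul_sq (b := 1 / 2) (by norm_num)).congr (.of_forall fun u => ?_)
  dsimp only
  congr 1
  ring

lemma stdNormalCDF_sub (a b : ℝ) :
    stdNormalCDF b - stdNormalCDF a
      = (Real.sqrt (2 * Real.pi))⁻¹ * ∫ u in a..b, Real.exp (-u ^ 2 / 2) := by
  rw [stdNormalCDF, stdNormalCDF, ← mul_sub, intervalIntegral.integral_Iic_sub_Iic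
    integrable_exp_neg_sq_div_two.integrableOn integrable_exp_neg_sq_div_two.integrableOn]

lemma integral_exp_neg_sq_div_two_le {a : ℝ} (ha : 0 ≤ a) :
    ∫ u in -a..a, Real.exp (-u ^ 2 / 2) ≤ 2 * a := by
  have h := intervalIntegral.integral_mono_on (a := -a) (b := a) (by linarith)
    integrable_exp_neg_sq_div_two.intervalIntegrable
    (intervalIntegrable_const (c := (1 : ℝ)))
    (fun u _ => Real.exp_le_one_iff.2 (by nlinarith [sq_nonneg u]))
  simp only [intervalIntegral.integral_const, smul_eq_mul] at h
  linarith

lemma le_integral_exp_neg_sq_div_two {a : ℝ} (ha : 0 ≤ a) :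
    2 * a - a ^ 3 / 3 ≤ ∫ u in -a..a, Real.exp (-u ^ 2 / 2) := by
  have h := intervalIntegral.integral_mono_on (a := -a) (b := a)
    (f := fun u : ℝ => 1 - u ^ 2 / 2) (by linarith)
    (Continuous.intervalIntegrable (by fun_prop) _ _)
    integrable_exp_neg_sq_div_two.intervalIntegrable
    (fun u _ => by linarith [Real.add_one_le_exp (-u ^ 2 / 2)])
  rw [intervalIntegral.integral_sub (Continuous.intervalIntegrable (by fun_prop) _ _)
    (Continuous.intervalIntegrable (by fun_prop) _ _), intervalIntegral.integral_div,
    integral_pow] at h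
  simp only [intervalIntegral.integral_const, smul_eq_mul] at h
  norm_num at h
  linarith

lemma bachelierCall_sub_bsCall (Z₀ σ x : ℝ) :
    bachelierCall Z₀ σ x - bsCall Z₀ σ x
      = Z₀ / Real.sqrt (2 * Real.pi) * (2 * (σ * Real.sqrt x / 2)
        - ∫ u in -(σ * Real.sqrt x / 2)..(σ * Real.sqrt x / 2), Real.exp (-u ^ 2 / 2)) := by
  rw [bachelierCall, bsCall, stdNormalCDF_sub, Real.sqrt_div' x (by positivity)]
  ring

lemma bsCall_le_bachelierCall {Z₀ σ : ℝ} (hZ₀ : 0 ≤ Z₀) (hσ : 0 ≤ σ) (x : ℝ) :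
    0 ≤ bachelierCall Z₀ σ x - bsCall Z₀ σ x := by
  rw [bachelierCall_sub_bsCall]
  exact mul_nonneg (by positivity)
    (sub_nonneg.2 (integral_exp_neg_sq_div_two_le (by positivity)))

lemma bachelierCall_sub_bsCall_le {Z₀ σ x : ℝ} (hZ₀ : 0 ≤ Z₀) (hσ : 0 ≤ σ) (hx : 0 ≤ x) :
    bachelierCall Z₀ σ x - bsCall Z₀ σ x
      ≤ Z₀ / (12 * Real.sqrt (2 * Real.pi)) * σ ^ 3 * x ^ ((3 : ℝ) / 2) := by
  have hpow : x ^ ((3 : ℝ) / 2) = Real.sqrt x ^ 3 := by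
    rw [Real.sqrt_eq_rpow, ← Real.rpow_mul_natCast hx]
    norm_num
  have ha : 0 ≤ σ * Real.sqrt x / 2 := by positivity
  have h := le_integral_exp_neg_sq_div_two ha
  have ha3 := pow_nonneg ha 3
  rw [bachelierCall_sub_bsCall, hpow]
  calc
    _ ≤ Z₀ / Real.sqrt (2 * Real.pi) * (2 * (σ * Real.sqrt x / 2) ^ 3 / 3) := by
      gcongr
      linarith
    _ = _ := by ring

/-- Subordinated Schachermayer–Teichmann inequality: for a probability measure `μ`
concentrated on `[0,∞)` with finite `3/2`-moment,
`0 ≤ ∫ (C^Ba − C) dμ ≤ (Z₀/(12√(2π))) σ³ ∫ x^{3/2} dμ`. -/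
theorem subordinated_bachelier_vs_blackScholes (Z₀ σ : ℝ) (hZ₀ : 0 < Z₀) (hσ : 0 < σ)
    (μ : Measure ℝ) [IsProbabilityMeasure μ] (hsupp : ∀ᵐ x ∂μ, 0 ≤ x)
    (hmom : Integrable (fun x => x ^ ((3 : ℝ) / 2)) μ) :
    0 ≤ ∫ x, (bachelierCall Z₀ σ x - bsCall Z₀ σ x) ∂μ ∧
    ∫ x, (bachelierCall Z₀ σ x - bsCall Z₀ σ x) ∂μ
      ≤ Z₀ / (12 * Real.sqrt (2 * Real.pi)) * σ ^ 3 * ∫ x, x ^ ((3 : ℝ) / 2) ∂μ := by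
  refine ⟨integral_nonneg fun x => bsCall_le_bachelierCall hZ₀.le hσ.le x, ?_⟩
  rw [← integral_const_mul]
  refine integral_mono_of_nonneg (.of_forall fun x => bsCall_le_bachelierCall hZ₀.le hσ.le x)
    (hmom.const_mul _) ?_
  filter_upwards [hsupp] with x hx
  exact bachelierCall_sub_bsCall_le hZ₀.le hσ.le hx
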